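/- An arbitrary series f ∈ K⟨υ^{1/p^∞}⟩ is a unit of K⟨υ^{1/p^∞}⟩ if and only if its constant coefficient strictly dominates all other coefficients, i.e., if and only if |f(q)| < |f(0)| for all q ∈ D with q ≠ 0 (equivalently, ‖f − f(0)·1‖ < |f(0)|). -/

import Mathlib

open Filter

variable {K : Type*} [NontriviallyNormedField K] [IsUltrametricDist K] [CompleteSpace K]

/-- The exponent set `D = ℤ[1/p]_{≥0} = {a/p^b : a, b ∈ ℕ}`. -/
def Dset (p : ℕ) : Set ℚ := {q | ∃ a b : ℕ, q = (a : ℚ) / (p : ℚ) ^ b}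

/-- The exponent set `−D = {−a/p^b : a, b ∈ ℕ}`. -/
def negDset (p : ℕ) : Set ℚ := {q | ∃ a b : ℕ, q = -((a : ℚ) / (p : ℚ) ^ b)}

/-- The exponent set `ℤ[1/p] = {a/p^b : a ∈ ℤ, b ∈ ℕ}`. -/
def Zpset (p : ℕ) : Set ℚ := {q | ∃ (a : ℤ) (b : ℕ), q = (a : ℚ) / (p : ℚ) ^ b}

/-- Membership in the algebra of series supported on `S` with coefficients tending to `0`. -/
def MemAlg (S : Set ℚ) (f : ℚ → K) : Prop :=
  (∀ q, q ∉ S → f q = 0) ∧ Filter.Tendsto f Filter.cofinite (nhds 0)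

/-- The Gauss norm `‖f‖ = sup_q |f q|`. -/
noncomputable def gaussNorm (f : ℚ → K) : ℝ := ⨆ q : ℚ, ‖f q‖

/-- Convolution product of series. -/
noncomputable def conv (f g : ℚ → K) : ℚ → K := fun q => ∑' r : ℚ, f r * g (q - r)

/-- The multiplicative unit: the series `1`. -/
def oneF : ℚ → K := fun q => if q = 0 then 1 else 0

/-- `υ^d`: the series supported at the single exponent `d` with coefficient `1`. -/
def upsilon (d : ℚ) : ℚ → K := fun q => if q = d then 1 else 0

/-- `f` is a unit of the algebra of series supported on `S`. -/
def IsUnitIn (S : Set ℚ) (f : ℚ → K) : Prop :=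
  MemAlg S f ∧ ∃ g : ℚ → K, MemAlg S g ∧ conv f g = oneF ∧ conv g f = oneF

theorem aux_max (f : ℚ → K) (hf : Tendsto f cofinite (nhds 0)) :
    ∃ a, ∀ q, ‖f q‖ ≤ ‖f a‖ := by
  by_cases h : ∀ q, f q = 0
  · exact ⟨0, fun q => by simp [h]⟩
  · push Not at h
    obtain ⟨b, hb⟩ := h
    have hb' : 0 < ‖f b‖ := norm_pos_iff.2 hb
    have hfin : {q | ¬ ‖f q‖ < ‖f b‖}.Finite := by
      have h1 : Tendsto (fun q => ‖f q‖) cofinite (nhds 0) := by simpa using hf.norm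
      exact h1.eventually_lt_const hb'
    obtain ⟨a, ha, hmax⟩ := Set.exists_max_image _ (fun q => ‖f q‖) hfin ⟨b, by simp⟩
    refine ⟨a, fun q => ?_⟩
    by_cases hq : ‖f q‖ < ‖f b‖
    · exact hq.le.trans (hmax b (by simp))
    · exact hmax q hq

theorem aux_lastmax (f : ℚ → K) (hf : Tendsto f cofinite (nhds 0)) (hne : ∃ q, f q ≠ 0) :
    ∃ a, f a ≠ 0 ∧ (∀ q, ‖f q‖ ≤ ‖f a‖) ∧ ∀ q, a < q → ‖f q‖ < ‖f a‖ := by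
  obtain ⟨b, hb⟩ := aux_max f hf
  obtain ⟨c, hc⟩ := hne
  have hb' : 0 < ‖f b‖ := (norm_pos_iff.2 hc).trans_le (hb c)
  have hfin : {q | ¬ ‖f q‖ < ‖f b‖}.Finite := by
    have h1 : Tendsto (fun q => ‖f q‖) cofinite (nhds 0) := by simpa using hf.norm
    exact h1.eventually_lt_const hb'
  obtain ⟨a, ha, hmax⟩ := Set.exists_max_image _ (fun q => q) hfin ⟨b, by simp⟩
  have hab : ‖f a‖ = ‖f b‖ := le_antisymm (hb a) (not_lt.1 ha)
  refine ⟨a, norm_pos_iff.1 (hab ▸ hb'), fun q => hab ▸ hb q, fun q hq => ?_⟩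
  by_contra hcon
  rw [hab] at hcon
  exact absurd (hmax q hcon) (not_le.2 hq)

theorem aux_term (f g : ℚ → K) (hf : Tendsto f cofinite (nhds 0))
    (hg : Tendsto g cofinite (nhds 0)) (q : ℚ) :
    Tendsto (fun r => f r * g (q - r)) cofinite (nhds 0) := by
  have h := hf.mul (hg.comp (sub_right_injective (b := q)).tendsto_cofinite)
  simpa using h

theorem aux_summable (f g : ℚ → K) (hf : Tendsto f cofinite (nhds 0))
    (hg : Tendsto g cofinite (nhds 0)) (q : ℚ) :
    Summable (fun r => f r * g (q - r)) :=
  NonarchimedeanAddGroup.summable_of_tendsto_cofinite_zero (aux_term f g hf hg q)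

theorem conv_comm' (f g : ℚ → K) : conv f g = conv g f := by
  funext q
  unfold conv
  rw [← (Equiv.subLeft q).tsum_eq]
  simp [mul_comm]

theorem conv_norm_le (f g : ℚ → K) (A B : ℝ) (hA : ∀ q, ‖f q‖ ≤ A) (hB : ∀ q, ‖g q‖ ≤ B) (q : ℚ) :
    ‖conv f g q‖ ≤ A * B := by
  refine IsUltrametricDist.norm_tsum_le_of_forall_le fun r => ?_
  rw [norm_mul]
  exact mul_le_mul (hA _) (hB _) (norm_nonneg _) ((norm_nonneg _).trans (hA 0))

theorem conv_ne_zero (f g : ℚ → K) (hf : Tendsto f cofinite (nhds 0))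
    (hg : Tendsto g cofinite (nhds 0)) (a b : ℚ) (ha : f a ≠ 0) (hb : g b ≠ 0)
    (hfa : ∀ q, ‖f q‖ ≤ ‖f a‖) (hfa' : ∀ q, a < q → ‖f q‖ < ‖f a‖)
    (hgb : ∀ q, ‖g q‖ ≤ ‖g b‖) (hgb' : ∀ q, b < q → ‖g q‖ < ‖g b‖) :
    conv f g (a + b) ≠ 0 := by
  intro h0
  have hs := aux_summable f g hf hg (a + b)
  unfold conv at h0
  rw [hs.tsum_eq_add_tsum_ite a] at h0
  set t : ℚ → K := fun r => if r = a then 0 else f r * g (a + b - r) with ht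
  have htend : Tendsto t cofinite (nhds 0) := by
    refine squeeze_zero_norm (a := fun r => ‖f r * g (a + b - r)‖) (fun r => ?_)
      (by simpa using (aux_term f g hf hg (a + b)).norm)
    simp only [ht]
    split_ifs
    · rw [norm_zero]; exact norm_nonneg _
    · exact le_rfl
  obtain ⟨m, hm⟩ := aux_max t htend
  have hlt : ‖t m‖ < ‖f a‖ * ‖g b‖ := by
    have hfa0 := norm_pos_iff.2 ha
    have hgb0 := norm_pos_iff.2 hb
    simp only [ht]
    split_ifs with hma
    · simpa using mul_pos hfa0 hgb0
    · rw [norm_mul]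
      rcases lt_or_gt_of_ne hma with hlt | hgt
      · have := hgb' (a + b - m) (by linarith)
        calc _ ≤ ‖f a‖ * ‖g (a + b - m)‖ := by gcongr; exact hfa m
          _ < _ := by gcongr
      · have := hfa' m hgt
        calc _ ≤ ‖f m‖ * ‖g b‖ := by gcongr; exact hgb _
          _ < _ := by gcongr
  have h1 : ‖∑' r, t r‖ ≤ ‖t m‖ := IsUltrametricDist.norm_tsum_le_of_forall_le hm
  have h2 : f a * g (a + b - a) = - ∑' r, t r := eq_neg_of_add_eq_zero_left h0
  have h3 : ‖f a‖ * ‖g b‖ = ‖∑' r, t r‖ := by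
    rw [← norm_neg (∑' r, t r), ← h2, norm_mul]; simp
  linarith

theorem Dset_add (p : ℕ) (hp : p.Prime) {x y : ℚ} (hx : x ∈ Dset p) (hy : y ∈ Dset p) :
    x + y ∈ Dset p := by
  obtain ⟨a, b, rfl⟩ := hx
  obtain ⟨c, d, rfl⟩ := hy
  have : (p : ℚ) ≠ 0 := by exact_mod_cast hp.ne_zero
  refine ⟨a * p ^ d + c * p ^ b, b + d, ?_⟩
  push_cast
  rw [pow_add]
  field_simp

theorem conv_tendsto (f g : ℚ → K) (hf : Tendsto f cofinite (nhds 0))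
    (hg : Tendsto g cofinite (nhds 0)) : Tendsto (conv f g) cofinite (nhds 0) := by
  obtain ⟨a, ha⟩ := aux_max f hf
  obtain ⟨b, hb⟩ := aux_max g hg
  set A := ‖f a‖ + ‖g b‖ + 1 with hA
  have hApos : 0 < A := by positivity
  have hfA : ∀ q, ‖f q‖ ≤ A := fun q => by linarith [ha q, norm_nonneg (g b)]
  have hgA : ∀ q, ‖g q‖ ≤ A := fun q => by linarith [hb q, norm_nonneg (f a)]
  rw [Metric.tendsto_nhds]
  intro ε hε
  have hδ : 0 < ε / 2 / A := by positivity
  have hF : {q | ¬ ‖f q‖ < ε / 2 / A}.Finite := by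
    have h1 : Tendsto (fun q => ‖f q‖) cofinite (nhds 0) := by simpa using hf.norm
    exact h1.eventually_lt_const hδ
  have hG : {q | ¬ ‖g q‖ < ε / 2 / A}.Finite := by
    have h1 : Tendsto (fun q => ‖g q‖) cofinite (nhds 0) := by simpa using hg.norm
    exact h1.eventually_lt_const hδ
  refine ((hF.image2 (fun x y => x + y) hG)).subset ?_
  intro q hq
  by_contra hcon
  apply hq
  have : ‖conv f g q‖ ≤ ε / 2 := by
    refine IsUltrametricDist.norm_tsum_le_of_forall_le fun r => ?_
    rw [norm_mul]
    have he : ε / 2 = ε / 2 / A * A := by field_simp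
    by_cases h1 : ‖f r‖ < ε / 2 / A
    · rw [he]
      exact mul_le_mul h1.le (hgA _) (norm_nonneg _) hδ.le
    · by_cases h2 : ‖g (q - r)‖ < ε / 2 / A
      · rw [he, mul_comm]
        exact mul_le_mul h2.le (hfA _) (norm_nonneg _) hδ.le
      · exact absurd ⟨r, h1, q - r, h2, by simp⟩ hcon
  simp only [dist_zero_right, Set.mem_setOf_eq]
  linarith

theorem conv_mem (p : ℕ) (hp : p.Prime) (f g : ℚ → K) (hf : MemAlg (Dset p) f)
    (hg : MemAlg (Dset p) g) : MemAlg (Dset p) (conv f g) := by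
  refine ⟨fun q hq => ?_, conv_tendsto f g hf.2 hg.2⟩
  unfold conv
  convert tsum_zero with r
  by_cases h1 : r ∈ Dset p
  · by_cases h2 : q - r ∈ Dset p
    · exact absurd (by simpa using Dset_add p hp h1 h2) hq
    · simp [hg.1 _ h2]
  · simp [hf.1 _ h1]

theorem conv_sub' (f g h : ℚ → K) (hf : Tendsto f cofinite (nhds 0))
    (hg : Tendsto g cofinite (nhds 0)) (hh : Tendsto h cofinite (nhds 0)) (q : ℚ) :
    conv f (fun r => g r - h r) q = conv f g q - conv f h q := by
  unfold conv
  rw [← (aux_summable f g hf hg q).tsum_sub (aux_summable f h hf hh q)]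
  simp [mul_sub]

theorem one_mem (p : ℕ) : MemAlg (Dset p) (oneF : ℚ → K) := by
  refine ⟨fun q hq => ?_, ?_⟩
  · have : q ≠ 0 := by
      rintro rfl
      exact hq ⟨0, 0, by simp⟩
    simp [oneF, this]
  · refine tendsto_const_nhds.congr' ?_
    have : ∀ᶠ q : ℚ in cofinite, q ≠ 0 := by simp [Filter.eventually_cofinite]
    filter_upwards [this] with q hq
    simp [oneF, hq]

theorem one_conv (g : ℚ → K) (q : ℚ) : conv oneF g q = g q := by
  unfold conv
  rw [tsum_eq_single 0]
  · simp [oneF]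
  · intro r hr
    simp [oneF, hr]

/-- Picard iteration. -/
noncomputable def picard (h e : ℚ → K) : ℕ → ℚ → K
  | 0 => fun _ => 0
  | n + 1 => fun q => e q + conv h (picard h e n) q

theorem fixed (p : ℕ) (hp : p.Prime) (h e : ℚ → K) (hh : MemAlg (Dset p) h)
    (he : MemAlg (Dset p) e) (ρ : ℝ) (hρ0 : 0 ≤ ρ) (hρ : ρ < 1) (hhρ : ∀ q, ‖h q‖ ≤ ρ) :
    ∃ g, MemAlg (Dset p) g ∧ ∀ q, g q = e q + conv h g q := by
  set u := picard h e with hu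
  have hmem : ∀ n, MemAlg (Dset p) (u n) := by
    intro n
    induction n with
    | zero => exact ⟨fun _ _ => rfl, tendsto_const_nhds⟩
    | succ n ih =>
      have hc := conv_mem p hp h (u n) hh ih
      refine ⟨fun q hq => ?_, ?_⟩
      · change e q + conv h (u n) q = 0
        rw [he.1 q hq, hc.1 q hq, add_zero]
      · have h3 := he.2.add hc.2
        rw [add_zero] at h3
        exact h3
  obtain ⟨a, ha⟩ := aux_max e he.2
  set C := ‖e a‖ with hC
  have hdist : ∀ n q, ‖u n q - u (n + 1) q‖ ≤ C * ρ ^ n := by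
    intro n
    induction n with
    | zero =>
      intro q
      have : u 1 q = e q := by
        change e q + conv h (fun _ => 0) q = e q
        simp [conv]
      have h0 : u 0 q = 0 := rfl
      rw [zero_add, this, h0]
      simpa using ha q
    | succ n ih =>
      intro q
      have : u (n + 1) q - u (n + 1 + 1) q = conv h (fun r => u n r - u (n + 1) r) q := by
        rw [conv_sub' h _ _ hh.2 (hmem n).2 (hmem (n + 1)).2]
        change (e q + conv h (u n) q) - (e q + conv h (u (n + 1)) q) = _
        ring
      rw [this]
      refine (conv_norm_le h _ ρ _ hhρ ih q).trans (le_of_eq ?_)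
      ring
  have hlim : ∀ q, ∃ l, Tendsto (fun n => u n q) atTop (nhds l) := fun q =>
    cauchySeq_tendsto_of_complete
      (cauchySeq_of_le_geometric ρ C hρ (fun n => by rw [dist_eq_norm]; exact hdist n q))
  choose g hg using hlim
  have hbd : ∀ n q, ‖u n q - g q‖ ≤ C * ρ ^ n / (1 - ρ) := fun n q => by
    rw [← dist_eq_norm]
    exact dist_le_of_le_geometric_of_tendsto ρ C hρ
      (fun n => by rw [dist_eq_norm]; exact hdist n q) (hg q) n
  have hto : Tendsto (fun n => C * ρ ^ n / (1 - ρ)) atTop (nhds 0) := by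
    have := ((tendsto_pow_atTop_nhds_zero_of_lt_one hρ0 hρ).const_mul C).div_const (1 - ρ)
    simpa using this
  have hgmem : MemAlg (Dset p) g := by
    refine ⟨fun q hq => ?_, ?_⟩
    · refine tendsto_nhds_unique (hg q) ?_
      simp [(hmem _).1 q hq]
    · rw [Metric.tendsto_nhds]
      intro ε hε
      obtain ⟨n, hn⟩ := (hto.eventually_lt_const (half_pos hε)).exists
      have h2 := (Metric.tendsto_nhds.1 (hmem n).2) (ε / 2) (half_pos hε)
      filter_upwards [h2] with q hq
      rw [dist_zero_right] at hq ⊢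
      have := norm_sub_norm_le (g q) (u n q)
      have h3 := hbd n q
      rw [norm_sub_rev] at h3
      linarith
  refine ⟨g, hgmem, fun q => ?_⟩
  have h1 : Tendsto (fun n => conv h (u n) q) atTop (nhds (conv h g q)) := by
    rw [tendsto_iff_norm_sub_tendsto_zero]
    refine squeeze_zero (fun _ => norm_nonneg _) (fun n => ?_)
      (by simpa using hto.const_mul ρ)
    rw [← conv_sub' h _ _ hh.2 (hmem n).2 hgmem.2]
    exact conv_norm_le h _ ρ _ hhρ (hbd n) q
  exact tendsto_nhds_unique ((tendsto_add_atTop_iff_nat 1).2 (hg q)) (h1.const_add (e q))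

theorem Dset_nonneg (p : ℕ) {x : ℚ} (hx : x ∈ Dset p) : 0 ≤ x := by
  obtain ⟨a, b, rfl⟩ := hx
  positivity

/-- an arbitrary series `f ∈ K⟨υ^{1/p^∞}⟩` is a unit iff its constant
coefficient strictly dominates all other coefficients: `|f q| < |f 0|` for all `q ≠ 0`. -/
theorem isUnit_iff_constant_dominates (p : ℕ) (hp : p.Prime)
    (f : ℚ → K) (hf : MemAlg (Dset p) f) :
    IsUnitIn (Dset p) f ↔ (∀ q : ℚ, q ≠ 0 → ‖f q‖ < ‖f 0‖) := by
  constructor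
  · rintro ⟨-, g, hg, hfg, -⟩
    have hnz : conv f g 0 ≠ 0 := by rw [hfg]; simp [oneF]
    have hfne : ∃ q, f q ≠ 0 := by
      by_contra! h
      exact hnz (by simp [conv, h])
    have hgne : ∃ q, g q ≠ 0 := by
      by_contra! h
      exact hnz (by simp [conv, h])
    obtain ⟨a, ha, ha1, ha2⟩ := aux_lastmax f hf.2 hfne
    obtain ⟨b, hb, hb1, hb2⟩ := aux_lastmax g hg.2 hgne
    have hne := conv_ne_zero f g hf.2 hg.2 a b ha hb ha1 ha2 hb1 hb2
    have hab : a + b = 0 := by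
      by_contra hcon
      rw [hfg] at hne
      simp [oneF, hcon] at hne
    have haD : 0 ≤ a := Dset_nonneg p (by by_contra hcon; exact ha (hf.1 a hcon))
    have hbD : 0 ≤ b := Dset_nonneg p (by by_contra hcon; exact hb (hg.1 b hcon))
    obtain rfl : a = 0 := by linarith
    intro q hq
    by_cases hqD : q ∈ Dset p
    · exact ha2 q (lt_of_le_of_ne (Dset_nonneg p hqD) hq.symm)
    · rw [hf.1 q hqD, norm_zero]
      exact norm_pos_iff.2 ha
  · intro hdom
    have hc : f 0 ≠ 0 := norm_pos_iff.1 ((norm_nonneg _).trans_lt (hdom 1 one_ne_zero))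
    have h1 := one_mem (K := K) p
    set h : ℚ → K := fun q => oneF q - (f 0)⁻¹ * f q with hh
    have hmem : MemAlg (Dset p) h := by
      refine ⟨fun q hq => by simp [hh, h1.1 q hq, hf.1 q hq], ?_⟩
      simpa using h1.2.sub (hf.2.const_mul (f 0)⁻¹)
    have hemem : MemAlg (Dset p) (fun q => (f 0)⁻¹ * (oneF q : K)) := by
      refine ⟨fun q hq => by simp [h1.1 q hq], ?_⟩
      simpa using h1.2.const_mul (f 0)⁻¹
    obtain ⟨m, hm⟩ := aux_max h hmem.2
    have hm1 : ‖h m‖ < 1 := by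
      by_cases hm0 : m = 0
      · simp [hh, hm0, oneF, hc]
      · have := hdom m hm0
        simp only [hh, oneF, hm0, if_false, zero_sub, norm_neg, norm_mul, norm_inv]
        rw [inv_mul_lt_iff₀ (norm_pos_iff.2 hc)]
        simpa using this
    obtain ⟨g, hg, hgfix⟩ := fixed p hp h _ hmem hemem ‖h m‖ (norm_nonneg _) hm1 hm
    have hfg : conv f g = oneF := by
      funext q
      have e1 : conv g h q = conv g oneF q - conv g (fun r => (f 0)⁻¹ * f r) q :=
        conv_sub' g _ _ hg.2 h1.2 (by simpa using hf.2.const_mul (f 0)⁻¹) q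
      have e2 : conv g (fun r => (f 0)⁻¹ * f r) q = (f 0)⁻¹ * conv g f q := by
        unfold conv
        rw [← tsum_mul_left]
        exact tsum_congr fun r => by ring
      have e3 := hgfix q
      rw [conv_comm' h g, e1, e2, conv_comm' g oneF, one_conv, conv_comm' g f] at e3
      have e4 : (f 0)⁻¹ * conv f g q = (f 0)⁻¹ * oneF q := by linear_combination e3
      exact mul_left_cancel₀ (inv_ne_zero hc) e4
    exact ⟨hf, g, hg, hfg, by rw [conv_comm']; exact hfg⟩
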